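/- arXiv:2201.12224 — 2 statements merged into one kernel-verified Lean document; each statement's English description precedes it below -/
import Mathlib

section
/- The virtual game admits a pure-strategy Nash equilibrium: there exists ρ* ∈ P such that V_i(ρ_i, ρ*_{-i}) ≤ V_i(ρ*) for every player i and every ρ_i ∈ P_i. -/
open scoped BigOperators
open Finset

noncomputable section

/-- The probability simplex on a finite set `X`. -/
def probSimplex (X : Type*) [Fintype X] : Set (X → ℝ) :=
  {x | (∀ p, 0 ≤ x p) ∧ ∑ p, x p = 1}

/-- Payoff of a player with reward `ri` at a profile `ρ` in the virtual game. -/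
def payoff {n : ℕ} {S A : Fin n → Type*} [∀ j, Fintype (S j)] [∀ j, Fintype (A j)]
    (ri : (∀ j, S j) → (∀ j, A j) → ℝ) (ρ : ∀ j, S j × A j → ℝ) : ℝ :=
  ∑ s : ∀ j, S j, ∑ a : ∀ j, A j, (∏ j, ρ j (s j, a j)) * ri s a

/-- In Scarf's combinatorial setting, where each index `i` ranks the points of `T` by `r i`, a pair
`(σ, C)` is dominant if every point is ranked weakly below all of `σ` by some index in `C`. -/
def Dominant {T I : Type*} (r : I → T → ℕ) (σ : Finset T) (C : Finset I) : Prop :=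
  ∀ y, ∃ i ∈ C, ∀ x ∈ σ, r i y ≤ r i x

/-- The index set completing a set `τ` of coloured points to a door of type `i₀`. -/
def doorIndex {T I : Type*} [DecidableEq I] (c : T → I) (i₀ : I) (τ : Finset T) : Finset I :=
  insert i₀ (τ.image c)

/-- The set `τ` carries a door of type `i₀`: its colours are distinct and differ from `i₀`. -/
def IsDoor {T I : Type*} (c : T → I) (i₀ : I) (τ : Finset T) : Prop :=
  Set.InjOn c τ ∧ ∀ x ∈ τ, c x ≠ i₀

theorem card_doorIndex {T I : Type*} [DecidableEq I] {c : T → I} {i₀ : I} {τ : Finset T}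
    (h : IsDoor c i₀ τ) : (doorIndex c i₀ τ).card = τ.card + 1 := by
  rw [doorIndex, card_insert_of_notMem, card_image_of_injOn h.1]
  simpa using h.2

theorem exists_rank_min {T I : Type*} (r : I → T → ℕ) {τ : Finset T} (hτ : τ.Nonempty) :
    ∃ m : I → T, (∀ i, m i ∈ τ) ∧ ∀ i, ∀ x ∈ τ, r i (m i) ≤ r i x := by
  have h : ∀ i, ∃ t, t ∈ τ ∧ ∀ x ∈ τ, r i t ≤ r i x := fun i => by
    obtain ⟨t, ht, h⟩ := exists_min_image τ (r i) hτ
    exact ⟨t, ht, h⟩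
  choose m h1 h2 using h
  exact ⟨m, h1, h2⟩

theorem card_eq_two_of_labelling {α β : Type*} {S : Finset α} (L : α → β → Prop) {j k : β}
    (hj : ∃ R ∈ S, L R j ∧ ∀ R' ∈ S, L R' j → R' = R)
    (hk : ∃ R ∈ S, L R k ∧ ∀ R' ∈ S, L R' k → R' = R)
    (hjk : ∀ R ∈ S, L R j → ¬ L R k) (h : ∀ R ∈ S, L R j ∨ L R k) : S.card = 2 := by
  classical
  obtain ⟨R, hR, hRj, hR'⟩ := hj
  obtain ⟨Q, hQ, hQk, hQ'⟩ := hk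
  refine card_eq_two.2 ⟨R, Q, fun e => hjk R hR hRj (e ▸ hQk), ?_⟩
  ext X
  simp only [mem_insert, mem_singleton]
  constructor
  · intro hX
    exact (h X hX).imp (hR' X hX) (hQ' X hX)
  · rintro (rfl | rfl) <;> assumption

section Scarf

variable {T I : Type*} [DecidableEq T] [DecidableEq I] {r : I → T → ℕ}

/-- The dominant pairs obtained from `(τ, D)` by removing an index or adding a point. -/
def IsRoomOf (r : I → T → ℕ) (τ : Finset T) (D : Finset I) (R : Finset T × Finset I) : Prop :=
  Dominant r R.1 R.2 ∧ ((∃ j ∈ D, R = (τ, D.erase j)) ∨ ∃ x ∉ τ, R = (insert x τ, D))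

theorem isRoomOf_doorIndex_iff {c : T → I} {i₀ : I} {σ τ : Finset T} {C : Finset I}
    (hd : Dominant r σ C) (hτ : IsDoor c i₀ τ) (hC : σ.image c ≠ C) :
    IsRoomOf r τ (doorIndex c i₀ τ) (σ, C) ↔
      (τ = σ ∧ ∃ x ∈ σ, C = (doorIndex c i₀ σ).erase (c x)) ∨
        ∃ x ∈ σ, τ = σ.erase x ∧ C = doorIndex c i₀ τ := by
  constructor
  · rintro ⟨-, ⟨j, hj, h⟩ | ⟨x, hx, h⟩⟩
    · obtain ⟨h1, h2⟩ := Prod.ext_iff.1 h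
      simp only at h1 h2
      subst h1 h2
      left
      refine ⟨rfl, ?_⟩
      rcases mem_insert.1 hj with rfl | hj
      · refine absurd ?_ hC
        simp only [doorIndex]
        rw [erase_insert]
        simpa using hτ.2
      · obtain ⟨x, hx, rfl⟩ := mem_image.1 hj
        exact ⟨x, hx, rfl⟩
    · obtain ⟨h1, h2⟩ := Prod.ext_iff.1 h
      simp only at h1 h2
      subst h1 h2
      exact Or.inr ⟨x, mem_insert_self _ _, by rw [erase_insert hx], rfl⟩
  · rintro (⟨rfl, x, hx, rfl⟩ | ⟨x, hx, rfl, rfl⟩)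
    · exact ⟨hd, Or.inl ⟨c x, mem_insert_of_mem (mem_image_of_mem c hx), rfl⟩⟩
    · exact ⟨hd, Or.inr ⟨x, by simp, by rw [insert_erase hx]⟩⟩

theorem even_card_doors {c : T → I} {i₀ : I} {σ : Finset T} {C : Finset I}
    (hd : Dominant r σ C) (hC : σ.image c ≠ C) {S : Finset (Finset T)}
    (hS : ∀ τ, τ ∈ S ↔ IsDoor c i₀ τ ∧ IsRoomOf r τ (doorIndex c i₀ τ) (σ, C)) :
    Even S.card := by
  have hS' : ∀ τ, τ ∈ S ↔ IsDoor c i₀ τ ∧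
      ((τ = σ ∧ ∃ x ∈ σ, C = (doorIndex c i₀ σ).erase (c x)) ∨
        ∃ x ∈ σ, τ = σ.erase x ∧ C = doorIndex c i₀ τ) := fun τ => by
    rw [hS]
    exact and_congr_right fun h => isRoomOf_doorIndex_iff hd h hC
  rcases S.eq_empty_or_nonempty with rfl | ⟨τ, hτS⟩
  · simp
  suffices h : S.card = 2 by simp [h]
  have herase : ∀ x, IsDoor c i₀ σ → x ∈ σ →
      (doorIndex c i₀ σ).erase (c x) = doorIndex c i₀ (σ.erase x) := by
    intro x hσ hx
    ext i
    simp only [doorIndex, mem_erase, mem_insert, mem_image]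
    constructor
    · rintro ⟨hi, rfl | ⟨y, hy, rfl⟩⟩
      · exact Or.inl rfl
      · exact Or.inr ⟨y, ⟨fun h => hi (h ▸ rfl), hy⟩, rfl⟩
    · rintro (rfl | ⟨y, ⟨hyx, hy⟩, rfl⟩)
      · exact ⟨(hσ.2 x hx).symm, Or.inl rfl⟩
      · exact ⟨fun h => hyx (hσ.1 hy hx h), Or.inr ⟨y, hy, rfl⟩⟩
  have hsub : ∀ x, IsDoor c i₀ σ → IsDoor c i₀ (σ.erase x) := fun x h =>
    ⟨h.1.mono (by simp), fun y hy => h.2 y (mem_of_mem_erase hy)⟩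
  by_cases hσ : IsDoor c i₀ σ
  · obtain ⟨x, hx, hCx⟩ : ∃ x ∈ σ, C = doorIndex c i₀ (σ.erase x) := by
      rcases ((hS' τ).1 hτS).2 with ⟨-, x, hx, h⟩ | ⟨x, hx, rfl, h⟩
      · exact ⟨x, hx, h.trans (herase x hσ hx)⟩
      · exact ⟨x, hx, h⟩
    refine card_eq_two.2 ⟨σ, σ.erase x, fun h => notMem_erase x σ (h ▸ hx), ?_⟩
    ext ρ
    rw [hS', mem_insert, mem_singleton]
    constructor
    · rintro ⟨-, ⟨h, -⟩ | ⟨y, hy, rfl, h⟩⟩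
      · exact Or.inl h
      · right
        have hxy : c x ∉ (doorIndex c i₀ σ).erase (c y) := by
          rw [herase y hσ hy, ← h, hCx, ← herase x hσ hx]
          simp
        have : c x = c y := by
          by_contra hne
          exact hxy (mem_erase.2 ⟨hne, mem_insert_of_mem (mem_image_of_mem c hx)⟩)
        rw [hσ.1 hx hy this]
    · rintro (rfl | rfl)
      · exact ⟨hσ, Or.inl ⟨rfl, x, hx, hCx.trans (herase x hσ hx).symm⟩⟩
      · exact ⟨hsub x hσ, Or.inr ⟨x, hx, rfl, hCx⟩⟩
  · have hS'' : ∀ τ, τ ∈ S ↔ IsDoor c i₀ τ ∧ ∃ x ∈ σ, τ = σ.erase x ∧ C = doorIndex c i₀ τ := by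
      intro τ
      rw [hS']
      refine and_congr_right fun h => or_iff_right ?_
      rintro ⟨rfl, -⟩
      exact hσ h
    obtain ⟨hτ, x, hx, rfl, hCx⟩ := (hS'' τ).1 hτS
    have hxi : c x ≠ i₀ := by
      intro h
      refine hC ?_
      rw [hCx, doorIndex, ← h, ← image_insert, insert_erase hx]
    obtain ⟨y, hy, hyx, hcy⟩ : ∃ y ∈ σ, y ≠ x ∧ c y = c x := by
      by_contra! hne
      refine hσ ⟨fun a ha b hb hab => ?_, fun a ha => ?_⟩
      · by_cases hax : a = x
        · subst hax
          by_contra hne'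
          exact hne b hb (Ne.symm hne') hab.symm
        · by_cases hbx : b = x
          · subst hbx
            exact absurd hab (hne a ha hax)
          · exact hτ.1 (mem_coe.2 (mem_erase.2 ⟨hax, ha⟩)) (mem_coe.2 (mem_erase.2 ⟨hbx, hb⟩)) hab
      · by_cases hax : a = x
        · exact hax ▸ hxi
        · exact hτ.2 a (mem_erase.2 ⟨hax, ha⟩)
    have himage : (σ.erase y).image c = (σ.erase x).image c := by
      ext i
      simp only [mem_image, mem_erase]
      constructor
      · rintro ⟨z, ⟨-, hz⟩, rfl⟩
        by_cases hzx : z = x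
        · exact ⟨y, ⟨hyx, hy⟩, hzx ▸ hcy⟩
        · exact ⟨z, ⟨hzx, hz⟩, rfl⟩
      · rintro ⟨z, ⟨-, hz⟩, rfl⟩
        by_cases hzy : z = y
        · exact ⟨x, ⟨hyx.symm, hx⟩, hzy ▸ hcy.symm⟩
        · exact ⟨z, ⟨hzy, hz⟩, rfl⟩
    refine card_eq_two.2 ⟨σ.erase x, σ.erase y, fun h => ?_, ?_⟩
    · exact notMem_erase y σ (h ▸ mem_erase.2 ⟨hyx, hy⟩)
    ext ρ
    rw [hS'', mem_insert, mem_singleton]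
    constructor
    · rintro ⟨hρ, z, hz, rfl, -⟩
      by_contra! hne
      have hzx : z ≠ x := fun h => hne.1 (h ▸ rfl)
      have hzy : z ≠ y := fun h => hne.2 (h ▸ rfl)
      exact hyx (hρ.1 (mem_coe.2 (mem_erase.2 ⟨hzy.symm, hy⟩))
        (mem_coe.2 (mem_erase.2 ⟨hzx.symm, hx⟩)) hcy)
    · rintro (rfl | rfl)
      · exact ⟨hτ, x, hx, rfl, hCx⟩
      · refine ⟨⟨?_, ?_⟩, y, hy, rfl, ?_⟩
        · apply injOn_of_card_image_eq
          rw [himage, card_image_of_injOn hτ.1, card_erase_of_mem hx, card_erase_of_mem hy]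
        · intro z hz
          have : c z ∈ (σ.erase x).image c := himage ▸ mem_image_of_mem c hz
          obtain ⟨w, hw, h⟩ := mem_image.1 this
          exact h ▸ hτ.2 w hw
        · rw [hCx, doorIndex, doorIndex, himage]

variable [Fintype T]

theorem card_rooms_eq_two (hr : ∀ i, Function.Injective (r i)) {τ : Finset T} {D : Finset I}
    (hτ : τ.Nonempty) (hD : D.card = τ.card + 1) (hdom : Dominant r τ D)
    {S : Finset (Finset T × Finset I)} (hS : ∀ R, R ∈ S ↔ IsRoomOf r τ D R) : S.card = 2 := by
  obtain ⟨m, hm, hmin⟩ := exists_rank_min r hτ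
  have hsurj : ∀ C, Dominant r τ C → ∀ y ∈ τ, ∃ i ∈ C, m i = y := fun C hC y hy => by
    obtain ⟨i, hi, h⟩ := hC y
    exact ⟨i, hi, hr i (le_antisymm (hmin i y hy) (h _ (hm i)))⟩
  obtain ⟨j, hj, k, hk, hjk, hmjk⟩ := exists_ne_map_eq_of_card_lt_of_maps_to
    (by omega : τ.card < D.card) (fun i _ => hm i)
  have hpair : ∀ e ∈ D, (∀ y ∈ τ, ∃ i ∈ D.erase e, m i = y) → e = j ∨ e = k := by
    intro e he h
    by_contra! hne
    have him : (D.erase e).image m = τ := by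
      ext y
      simp only [mem_image]
      exact ⟨fun ⟨i, _, hi⟩ => hi ▸ hm i, h y⟩
    have hcard : ((D.erase e).image m).card = (D.erase e).card := by
      rw [him, card_erase_of_mem he]; omega
    exact hjk (injOn_of_card_image_eq hcard (by simp [hj, hne.1.symm]) (by simp [hk, hne.2.symm])
      hmjk)
  let L : Finset T × Finset I → I → Prop := fun R e =>
    R = (τ, D.erase e) ∨ ∃ x ∉ τ, R = (insert x τ, D) ∧ ∀ i ∈ D.erase e, r i (m i) < r i x
  have key : ∀ e ∈ D, (∀ y ∈ τ, ∃ i ∈ D.erase e, m i = y) →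
      ∃ R ∈ S, L R e ∧ ∀ R' ∈ S, L R' e → R' = R := by
    intro e he hs
    by_cases hde : Dominant r τ (D.erase e)
    · refine ⟨_, (hS _).2 ⟨hde, Or.inl ⟨e, he, rfl⟩⟩, Or.inl rfl, ?_⟩
      rintro R' - (h | ⟨x, -, -, hx⟩)
      · exact h
      · obtain ⟨i, hi, h⟩ := hde x
        exact absurd (h _ (hm i)) (not_le.2 (hx i hi))
    · have hY : (univ.filter fun y => ∀ i ∈ D.erase e, r i (m i) < r i y).Nonempty := by
        rw [Dominant] at hde
        push Not at hde
        obtain ⟨y, hy⟩ := hde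
        refine ⟨y, by
          simp only [mem_filter, mem_univ, true_and]
          intro i hi
          obtain ⟨x, hx, h⟩ := hy i hi
          exact (hmin i x hx).trans_lt h⟩
      obtain ⟨x, hx, hmax⟩ := exists_max_image _ (r e) hY
      simp only [mem_filter, mem_univ, true_and] at hx hmax
      have hxτ : x ∉ τ := fun h => by
        obtain ⟨i, hi, rfl⟩ := hs x h
        exact lt_irrefl _ (hx i hi)
      have hxe : ∀ t ∈ τ, r e x ≤ r e t := by
        obtain ⟨i, hi, h⟩ := hdom x
        by_cases hie : i = e
        · exact hie ▸ h
        · exact absurd (h _ (hm i)) (not_le.2 (hx i (mem_erase.2 ⟨hie, hi⟩)))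
      have hdx : Dominant r (insert x τ) D := by
        intro y
        by_cases hy : ∀ i ∈ D.erase e, r i (m i) < r i y
        · refine ⟨e, he, fun t ht => ?_⟩
          rcases mem_insert.1 ht with rfl | ht
          · exact hmax y hy
          · exact (hmax y hy).trans (hxe t ht)
        · push Not at hy
          obtain ⟨i, hi, h⟩ := hy
          refine ⟨i, mem_of_mem_erase hi, fun t ht => ?_⟩
          rcases mem_insert.1 ht with rfl | ht
          · exact h.trans (hx i hi).le
          · exact h.trans (hmin i t ht)
      refine ⟨_, (hS _).2 ⟨hdx, Or.inr ⟨x, hxτ, rfl⟩⟩, Or.inr ⟨x, hxτ, rfl, hx⟩, ?_⟩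
      rintro R' hR' (rfl | ⟨x', -, rfl, hx'⟩)
      · exact absurd ((hS _).1 hR').1 hde
      · obtain ⟨i, hi, h⟩ := ((hS _).1 hR').1 x
        have hie : i = e := by
          by_contra hie
          exact absurd (h _ (mem_insert_of_mem (hm i)))
            (not_le.2 (hx i (mem_erase.2 ⟨hie, hi⟩)))
        subst hie
        rw [hr i (le_antisymm (h _ (mem_insert_self _ _)) (hmax x' hx'))]
  have hsj : ∀ y ∈ τ, ∃ i ∈ D.erase j, m i = y := fun y hy => by
    obtain ⟨i, hi, rfl⟩ := hsurj D hdom y hy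
    by_cases h : i = j
    · exact ⟨k, mem_erase.2 ⟨hjk.symm, hk⟩, h ▸ hmjk.symm⟩
    · exact ⟨i, mem_erase.2 ⟨h, hi⟩, rfl⟩
  have hsk : ∀ y ∈ τ, ∃ i ∈ D.erase k, m i = y := fun y hy => by
    obtain ⟨i, hi, rfl⟩ := hsurj D hdom y hy
    by_cases h : i = k
    · exact ⟨j, mem_erase.2 ⟨hjk, hj⟩, h ▸ hmjk⟩
    · exact ⟨i, mem_erase.2 ⟨h, hi⟩, rfl⟩
  refine card_eq_two_of_labelling L (key j hj hsj) (key k hk hsk) ?_ ?_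
  · rintro R - (rfl | ⟨x, hx, rfl, hxj⟩) (h | ⟨x', hx', h, hxk⟩)
    · have h2 : D.erase j = D.erase k := (Prod.ext_iff.1 h).2
      have : k ∈ D.erase j := mem_erase.2 ⟨hjk.symm, hk⟩
      rw [h2] at this
      simp at this
    · have h1 : τ = insert x' τ := (Prod.ext_iff.1 h).1
      exact hx' (insert_eq_self.1 h1.symm)
    · exact hx (insert_eq_self.1 (Prod.ext_iff.1 h).1)
    · have h1 : insert x τ = insert x' τ := (Prod.ext_iff.1 h).1
      have hxx : x = x' := by
        have := h1 ▸ mem_insert_self x τ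
        exact (mem_insert.1 this).resolve_right hx
      subst hxx
      obtain ⟨i, hi, h⟩ := hdom x
      by_cases hij : i = j
      · exact absurd (h _ (hm i)) (not_le.2 (hxk i (mem_erase.2 ⟨hij ▸ hjk, hi⟩)))
      · exact absurd (h _ (hm i)) (not_le.2 (hxj i (mem_erase.2 ⟨hij, hi⟩)))
  · intro R hR
    obtain ⟨hd, ⟨e, he, rfl⟩ | ⟨x, hx, rfl⟩⟩ := (hS R).1 hR
    · refine (hpair e he (hsurj _ hd)).imp ?_ ?_ <;> rintro rfl <;> exact Or.inl rfl
    · change Dominant r (insert x τ) D at hd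
      obtain ⟨e, he, hxe⟩ := hd x
      -- every point of `τ` is the minimum of `insert x τ` for some index
      have hs : ∀ y ∈ τ, ∃ i ∈ D.erase e, m i = y ∧ r i y < r i x := fun y hy => by
        obtain ⟨i, hi, h⟩ := hd y
        have hne : y ≠ x := fun h => hx (h ▸ hy)
        have hlt : r i y < r i x :=
          lt_of_le_of_ne (h x (mem_insert_self _ _)) fun h => hne (hr i h)
        refine ⟨i, mem_erase.2 ⟨?_, hi⟩,
          hr i (le_antisymm (hmin i y hy) (h _ (mem_insert_of_mem (hm i)))), hlt⟩
        rintro rfl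
        exact absurd (hxe y (mem_insert_of_mem hy)) (not_le.2 hlt)
      have hinj : Set.InjOn m (D.erase e) := by
        apply injOn_of_card_image_eq
        have him : (D.erase e).image m = τ := by
          ext y
          simp only [mem_image]
          refine ⟨fun ⟨i, _, hi⟩ => hi ▸ hm i, fun hy => ?_⟩
          obtain ⟨i, hi, h, -⟩ := hs y hy
          exact ⟨i, hi, h⟩
        rw [him, card_erase_of_mem he]; omega
      have hlt : ∀ i ∈ D.erase e, r i (m i) < r i x := fun i hi => by
        obtain ⟨i', hi', h, hlt⟩ := hs (m i) (hm i)
        rwa [hinj hi' hi h] at hlt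
      refine (hpair e he fun y hy => ?_).imp ?_ ?_
      · obtain ⟨i, hi, h, -⟩ := hs y hy
        exact ⟨i, hi, h⟩
      · rintro rfl
        exact Or.inr ⟨x, hx, rfl, hlt⟩
      · rintro rfl
        exact Or.inr ⟨x, hx, rfl, hlt⟩

theorem card_rooms_empty [Nonempty T] (hr : ∀ i, Function.Injective (r i)) (i₀ : I)
    {S : Finset (Finset T × Finset I)} (hS : ∀ R, R ∈ S ↔ IsRoomOf r ∅ {i₀} R) :
    S.card = 1 := by
  obtain ⟨x, -, hx⟩ := exists_max_image (univ : Finset T) (r i₀) univ_nonempty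
  refine card_eq_one.2 ⟨({x}, {i₀}), ?_⟩
  ext R
  rw [hS, mem_singleton]
  constructor
  · rintro ⟨hd, ⟨j, hj, rfl⟩ | ⟨y, -, rfl⟩⟩
    · obtain ⟨i, hi, -⟩ := hd x
      simp_all
    · obtain ⟨i, hi, h⟩ := hd x
      obtain rfl : i = i₀ := by simpa using hi
      rw [hr i (le_antisymm (h y (by simp)) (hx y (mem_univ _)))]
      simp
  · rintro rfl
    exact ⟨fun y => ⟨i₀, by simp, by simpa using hx y (mem_univ _)⟩, Or.inr ⟨x, by simp, by simp⟩⟩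
/-- **Scarf's lemma**: every colouring admits a dominant pair carrying all its colours. -/
theorem exists_dominant_image_eq [Fintype I] [Nonempty T] [Nonempty I]
    (hr : ∀ i, Function.Injective (r i)) (c : T → I) :
    ∃ σ : Finset T, Dominant r σ (σ.image c) := by
  classical
  by_contra! hne
  obtain ⟨i₀⟩ := ‹Nonempty I›
  let doors : Finset (Finset T) :=
    univ.filter fun τ => IsDoor c i₀ τ ∧ Dominant r τ (doorIndex c i₀ τ)
  let rooms : Finset (Finset T × Finset I) := univ.filter fun R => Dominant r R.1 R.2
  let inc : Finset T → Finset T × Finset I → Prop := fun τ R => IsRoomOf r τ (doorIndex c i₀ τ) R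
  have hcount := sum_card_bipartiteAbove_eq_sum_card_bipartiteBelow (s := doors) (t := rooms) inc
  have heven : Even (∑ R ∈ rooms, (doors.bipartiteBelow inc R).card) := by
    refine even_sum _ fun R hR => ?_
    have hR : Dominant r R.1 R.2 := by simpa [rooms] using hR
    refine even_card_doors (c := c) (i₀ := i₀) hR (fun h => hne R.1 (h ▸ hR)) fun τ => ?_
    simp only [mem_bipartiteBelow, doors, mem_filter, mem_univ, true_and, inc, and_assoc]
    refine and_congr_right fun _ => and_iff_right_of_imp ?_
    rintro ⟨-, ⟨j, hj, h⟩ | ⟨x, hx, h⟩⟩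
    · intro y
      obtain ⟨i, hi, hy⟩ := hR y
      rw [h] at hi hy
      exact ⟨i, mem_of_mem_erase hi, hy⟩
    · intro y
      obtain ⟨i, hi, hy⟩ := hR y
      rw [h] at hi hy
      exact ⟨i, hi, fun t ht => hy t (mem_insert_of_mem ht)⟩
  have hmem : ∀ τ R, R ∈ rooms.bipartiteAbove inc τ ↔ IsRoomOf r τ (doorIndex c i₀ τ) R := by
    intro τ R
    simp only [mem_bipartiteAbove, rooms, mem_filter, mem_univ, true_and, inc]
    exact and_iff_right_of_imp fun h => h.1
  have hempty : ∅ ∈ doors := by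
    simp [doors, IsDoor, Dominant, doorIndex]
  rw [← hcount, ← add_sum_erase _ _ hempty,
    card_rooms_empty hr i₀ (fun R => by rw [hmem]; simp [doorIndex])] at heven
  refine (Nat.not_even_iff_odd.2 ?_) heven
  refine odd_one.add_even (even_sum _ fun τ hτ => ?_)
  have hτ' : τ ≠ ∅ ∧ IsDoor c i₀ τ ∧ Dominant r τ (doorIndex c i₀ τ) := by
    simpa [doors] using hτ
  rw [card_rooms_eq_two hr (nonempty_iff_ne_empty.2 hτ'.1) (card_doorIndex hτ'.2.1) hτ'.2.2
    (hmem τ)]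
  exact even_two

end Scarf

/-- A colouring of the lattice points of a dilated simplex has a cluster of diameter at most the
number of coordinates in which every colour appears or has a small coordinate. -/
theorem exists_cluster {I : Type*} [Fintype I] [Nonempty I] (N : ℕ) (c : (I → ℕ) → I) :
    ∃ p : I → ℕ, ∑ i, p i = N ∧ ∀ i, ∃ q : I → ℕ, ∑ j, q j = N ∧
      (c q = i ∨ q i ≤ Fintype.card I) ∧
      ∀ j, q j ≤ p j + Fintype.card I ∧ p j ≤ q j + Fintype.card I := by
  classical
  let T := ↥(piAntidiag (univ : Finset I) N)
  have hT : ∀ x : I → ℕ, x ∈ piAntidiag (univ : Finset I) N ↔ ∑ i, x i = N := by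
    simp [mem_piAntidiag]
  have : Nonempty T := by
    obtain ⟨i⟩ := ‹Nonempty I›
    exact ⟨⟨Pi.single i N, by simp [hT]⟩⟩
  let e := Fintype.equivFin T
  let r : I → T → ℕ := fun i x => x.1 i * Fintype.card T + e x
  have hrle : ∀ i x y, r i x ≤ r i y → x.1 i ≤ y.1 i := by
    intro i x y h
    by_contra! hlt
    have h1 := Nat.mul_le_mul_right (Fintype.card T) hlt
    have h2 := (e y).2
    simp only [r] at h
    rw [Nat.succ_mul] at h1
    omega
  have hr : ∀ i, Function.Injective (r i) := by
    intro i x y h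
    have h1 := le_antisymm (hrle i x y h.le) (hrle i y x h.ge)
    simp only [r, h1] at h
    exact e.injective (Fin.ext (by omega))
  obtain ⟨σ, hσ⟩ := exists_dominant_image_eq hr (fun x : T => c x.1)
  set C := σ.image fun x : T => c x.1 with hC
  obtain ⟨i₁, hi₁, -⟩ := hσ (Classical.arbitrary T)
  obtain ⟨x₀, hx₀, -⟩ := mem_image.1 hi₁
  obtain ⟨m, hm, hmin⟩ := exists_rank_min r ⟨x₀, hx₀⟩
  let b : I → ℕ := fun i => if i ∈ C then (m i).1 i else 0
  have hb : ∀ x ∈ σ, ∀ i, b i ≤ x.1 i := by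
    intro x hx i
    simp only [b]
    split_ifs
    · exact hrle i _ _ (hmin i x hx)
    · exact Nat.zero_le _
  have hCcard : C.card ≤ Fintype.card I := card_le_univ C
  have hsum : N < ∑ i, b i + C.card := by
    by_contra! hle
    let y : I → ℕ := fun i =>
      b i + (if i ∈ C then 1 else 0) + (if i = i₁ then N - (∑ i, b i + C.card) else 0)
    have hy : ∑ i, y i = N := by
      simp only [y, sum_add_distrib, sum_ite_mem, univ_inter, sum_const, smul_eq_mul, mul_one,
        sum_ite_eq', mem_univ, if_true]
      omega
    obtain ⟨i, hi, h⟩ := hσ ⟨y, (hT y).2 hy⟩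
    have h1 := hrle i _ _ (h (m i) (hm i))
    simp only [y, b, hi, if_true] at h1
    omega
  have hub : ∀ x ∈ σ, ∀ i, x.1 i ≤ b i + Fintype.card I := by
    intro x hx i
    have h1 : ∑ j, x.1 j = N := (hT x.1).1 x.2
    have h2 : ∑ j ∈ univ.erase i, b j ≤ ∑ j ∈ univ.erase i, x.1 j :=
      sum_le_sum fun j _ => hb x hx j
    rw [← add_sum_erase _ _ (mem_univ i)] at h1 hsum
    omega
  refine ⟨x₀.1, (hT _).1 x₀.2, fun i => ?_⟩
  have hclose : ∀ x ∈ σ, ∀ j,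
      x.1 j ≤ x₀.1 j + Fintype.card I ∧ x₀.1 j ≤ x.1 j + Fintype.card I := by
    intro x hx j
    have h1 := hb x hx j
    have h2 := hub x hx j
    have h3 := hb x₀ hx₀ j
    have h4 := hub x₀ hx₀ j
    omega
  by_cases hi : i ∈ C
  · obtain ⟨x, hx, hxi⟩ := mem_image.1 hi
    exact ⟨x.1, (hT _).1 x.2, Or.inl hxi, hclose x hx⟩
  · refine ⟨x₀.1, (hT _).1 x₀.2, Or.inr ?_, hclose x₀ hx₀⟩
    simpa [b, hi] using hub x₀ hx₀ i

/-- **Brouwer's fixed point theorem** for the standard simplex. -/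
theorem exists_fixedPoint_stdSimplex {I : Type*} [Fintype I] [Nonempty I] {f : (I → ℝ) → I → ℝ}
    (hf : ContinuousOn f (stdSimplex ℝ I)) (hmaps : Set.MapsTo f (stdSimplex ℝ I) (stdSimplex ℝ I)) :
    ∃ x ∈ stdSimplex ℝ I, f x = x := by
  classical
  let sc : ℕ → (I → ℕ) → I → ℝ := fun N x i => (x i : ℝ) / (N + 1)
  have hsc : ∀ N x, ∑ i, x i = N + 1 → sc N x ∈ stdSimplex ℝ I := by
    intro N x hx
    refine ⟨fun i => by positivity, ?_⟩
    simp only [sc]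
    rw [← sum_div, ← Nat.cast_sum, hx]
    push_cast
    exact div_self (by positivity)
  have hcol : ∀ N x, ∃ i, ∑ i, x i = N + 1 → sc N x i ≤ f (sc N x) i := by
    intro N x
    by_cases hx : ∑ i, x i = N + 1
    · have h1 := hsc N x hx
      obtain ⟨i, -, hi⟩ := exists_le_of_sum_le (univ_nonempty (α := I))
        (h1.2.trans (hmaps h1).2.symm).le
      exact ⟨i, fun _ => hi⟩
    · exact ⟨Classical.arbitrary I, fun h => absurd h hx⟩
  choose c hc using hcol
  choose p hp q hq hcq hpq using fun N : ℕ => exists_cluster (N + 1) (c N)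
  let K : ℝ := Fintype.card I
  have hK : Filter.Tendsto (fun N : ℕ => K / ((N : ℝ) + 1)) Filter.atTop (nhds 0) :=
    by
    simpa [div_eq_mul_inv] using (tendsto_one_div_add_atTop_nhds_zero_nat (𝕜 := ℝ)).const_mul K
  obtain ⟨x, hx, φ, hφ, hlim⟩ := (isCompact_stdSimplex ℝ I).tendsto_subseq
    fun N => hsc N (p N) (hp N)
  have hKφ := hK.comp hφ.tendsto_atTop
  have hle : ∀ i, x i ≤ f x i := by
    intro i
    have hlim' : Filter.Tendsto (fun k => sc (φ k) (q (φ k) i)) Filter.atTop (nhds x) := by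
      rw [tendsto_pi_nhds] at hlim ⊢
      intro j
      have h0 : Filter.Tendsto (fun k => sc (φ k) (q (φ k) i) j - sc (φ k) (p (φ k)) j)
          Filter.atTop (nhds 0) := by
        refine squeeze_zero_norm (fun k => ?_) hKφ
        simp only [sc, Function.comp_apply, ← sub_div, norm_div, Real.norm_eq_abs]
        rw [abs_of_pos (by positivity : (0 : ℝ) < (φ k : ℝ) + 1)]
        gcongr
        obtain ⟨h1, h2⟩ := hpq (φ k) i j
        have h1' : (q (φ k) i j : ℝ) ≤ p (φ k) j + Fintype.card I := by exact_mod_cast h1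
        have h2' : (p (φ k) j : ℝ) ≤ q (φ k) i j + Fintype.card I := by exact_mod_cast h2
        exact abs_le.2 ⟨by simp only [K]; linarith, by simp only [K]; linarith⟩
      simpa using h0.add (hlim j)
    have hmem : ∀ k, sc (φ k) (q (φ k) i) ∈ stdSimplex ℝ I := fun k => hsc _ _ (hq _ _)
    have hflim : Filter.Tendsto (fun k => f (sc (φ k) (q (φ k) i))) Filter.atTop (nhds (f x)) :=
      (hf x hx).tendsto.comp
        (tendsto_nhdsWithin_iff.2 ⟨hlim', Filter.Eventually.of_forall hmem⟩)
    have hsub := (tendsto_pi_nhds.1 hlim' i).sub hKφ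
    rw [sub_zero] at hsub
    refine le_of_tendsto_of_tendsto' hsub (tendsto_pi_nhds.1 hflim i) fun k => ?_
    rcases hcq (φ k) i with h | h
    · have h1 := hc (φ k) _ (hq (φ k) i)
      rw [h] at h1
      have : 0 ≤ K / ((φ k : ℝ) + 1) := by positivity
      simp only [Function.comp_apply]
      linarith
    · refine le_trans ?_ ((hmaps (hmem k)).1 i)
      simp only [sc, Function.comp_apply, ← sub_div]
      apply div_nonpos_of_nonpos_of_nonneg _ (by positivity)
      have : (q (φ k) i i : ℝ) ≤ Fintype.card I := by exact_mod_cast h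
      simp only [K]
      linarith
  refine ⟨x, hx, funext fun i => ?_⟩
  exact ((sum_eq_sum_iff_of_le fun i _ => hle i).1 (hx.2.trans (hmaps hx).2.symm) i
    (mem_univ i)).symm

/-- **Ky Fan's minimax inequality** for functions continuous in the first variable. -/
theorem exists_forall_nonpos_of_concaveOn {E : Type*} [AddCommGroup E] [Module ℝ E]
    [TopologicalSpace E] [ContinuousAdd E] [ContinuousSMul ℝ E] {K : Set E} (hK : IsCompact K)
    (hne : K.Nonempty) {Φ : E → E → ℝ} (hcont : ∀ y, Continuous fun x => Φ x y)
    (hconc : ∀ x, ConcaveOn ℝ K (Φ x)) (hdiag : ∀ x, Φ x x ≤ 0) :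
    ∃ x ∈ K, ∀ y ∈ K, Φ x y ≤ 0 := by
  have hfin : ∀ F : Finset K, (K ∩ ⋂ y ∈ F, {x | Φ x y ≤ 0}).Nonempty := by
    intro F
    rcases F.eq_empty_or_nonempty with rfl | hF
    · simpa using hne
    have : Nonempty F := hF.to_subtype
    let pt : (F → ℝ) → E := fun t => ∑ k, t k • (k.1.1 : E)
    let g : (F → ℝ) → F → ℝ := fun t k => max 0 (Φ (pt t) k.1.1)
    have hpt : Continuous pt := by fun_prop
    have hg : ∀ k, Continuous fun t => g t k := fun k =>
      continuous_const.max ((hcont _).comp hpt)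
    have hg0 : ∀ t k, 0 ≤ g t k := fun t k => le_max_left _ _
    have hgs : ∀ t, 0 < 1 + ∑ k, g t k := fun t => by
      have := sum_nonneg fun k (_ : k ∈ univ) => hg0 t k
      linarith
    let f : (F → ℝ) → F → ℝ := fun t k => (t k + g t k) / (1 + ∑ k, g t k)
    have hf : Continuous f := continuous_pi fun k =>
      ((continuous_apply k).add (hg k)).div
        (continuous_const.add (continuous_finsetSum _ fun k _ => hg k)) fun t => (hgs t).ne'
    obtain ⟨t, ht, hft⟩ := exists_fixedPoint_stdSimplex hf.continuousOn fun t ht =>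
      ⟨fun k => div_nonneg (add_nonneg (ht.1 k) (hg0 t k)) (hgs t).le, by
        simp only [f]
        rw [← sum_div, sum_add_distrib, ht.2]
        exact div_self (hgs t).ne'⟩
    have hmem : pt t ∈ K := (hconc 0).1.sum_mem (fun k _ => ht.1 k) ht.2 fun k _ => k.1.2
    have hgt : ∀ k, g t k = t k * ∑ k, g t k := fun k => by
      have h := congr_fun hft k
      simp only [f] at h
      rw [div_eq_iff (hgs t).ne'] at h
      linarith
    have hjensen : ∑ k, t k * Φ (pt t) k.1.1 ≤ 0 :=
      ((hconc (pt t)).le_map_sum (fun k _ => ht.1 k) ht.2 fun k _ => k.1.2).trans (hdiag (pt t))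
    have hsum : ∑ k, g t k ≤ 0 := by
      by_contra! hpos
      have h1 : ∀ k, t k * g t k ≤ t k * Φ (pt t) k.1.1 := by
        intro k
        rcases (ht.1 k).eq_or_lt with h | h
        · simp [← h]
        · have h2 : 0 < g t k := by rw [hgt]; positivity
          have h3 : g t k = Φ (pt t) k.1.1 :=
            (max_choice _ _).resolve_left fun h => h2.ne' h
          rw [h3]
      obtain ⟨k, hk⟩ : ∃ k, 0 < t k := by
        by_contra! h
        have := sum_nonpos fun k (_ : k ∈ univ) => h k
        linarith [ht.2]
      have h2 : 0 < ∑ k, t k * g t k := by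
        refine sum_pos' (fun k _ => mul_nonneg (ht.1 k) (hg0 t k)) ⟨k, mem_univ k, ?_⟩
        rw [hgt]
        positivity
      linarith [sum_le_sum fun k (_ : k ∈ univ) => h1 k]
    refine ⟨pt t, hmem, Set.mem_iInter₂.2 fun y hy => ?_⟩
    have h1 : g t ⟨y, hy⟩ ≤ ∑ k, g t k := single_le_sum (fun k _ => hg0 t k) (mem_univ _)
    exact (le_max_right _ _).trans (h1.trans hsum)
  obtain ⟨x, hx, h⟩ := hK.inter_iInter_nonempty (fun y : K => {x | Φ x y ≤ 0})
    (fun y => isClosed_le (hcont y) continuous_const) hfin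
  exact ⟨x, hx, fun y hy => Set.mem_iInter.1 h ⟨y, hy⟩⟩

theorem continuous_payoff {n : ℕ} {S A : Fin n → Type*} [∀ j, Fintype (S j)] [∀ j, Fintype (A j)]
    (ri : (∀ j, S j) → (∀ j, A j) → ℝ) : Continuous (payoff ri) := by
  unfold payoff
  fun_prop

theorem payoff_update_combo {n : ℕ} {S A : Fin n → Type*} [∀ j, Fintype (S j)]
    [∀ j, Fintype (A j)] (ri : (∀ j, S j) → (∀ j, A j) → ℝ) (ρ : ∀ j, S j × A j → ℝ) (i : Fin n)
    (a b : ℝ) (u v : S i × A i → ℝ) :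
    payoff ri (Function.update ρ i (a • u + b • v)) =
      a * payoff ri (Function.update ρ i u) + b * payoff ri (Function.update ρ i v) := by
  have hprod : ∀ (w : S i × A i → ℝ) (s : ∀ j, S j) (α : ∀ j, A j),
      ∏ j, Function.update ρ i w j (s j, α j) =
        w (s i, α i) * ∏ j ∈ univ.erase i, ρ j (s j, α j) := by
    intro w s α
    rw [← mul_prod_erase _ _ (mem_univ i), Function.update_self]
    congr 1
    refine prod_congr rfl fun j hj => ?_
    rw [Function.update_of_ne (ne_of_mem_erase hj)]
  simp only [payoff, hprod, mul_sum, ← sum_add_distrib]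
  refine sum_congr rfl fun s _ => sum_congr rfl fun α _ => ?_
  simp only [Pi.add_apply, Pi.smul_apply, smul_eq_mul]
  ring

/-- The virtual game admits a pure-strategy Nash equilibrium. -/
theorem virtual_game_has_pure_NE
    {n : ℕ} {S A : Fin n → Type*}
    [∀ j, Fintype (S j)] [∀ j, Nonempty (S j)]
    [∀ j, Fintype (A j)] [∀ j, Nonempty (A j)]
    (r : ∀ _ : Fin n, (∀ j, S j) → (∀ j, A j) → ℝ)
    (P : ∀ i : Fin n, Set ((S i × A i) → ℝ))
    (hPne : ∀ i, (P i).Nonempty)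
    (hPcpt : ∀ i, IsCompact (P i))
    (hPcvx : ∀ i, Convex ℝ (P i))
    (hPsub : ∀ i, P i ⊆ probSimplex (S i × A i)) :
    ∃ ρstar : ∀ j, S j × A j → ℝ, (∀ i, ρstar i ∈ P i) ∧
      ∀ i : Fin n, ∀ ρi ∈ P i,
        payoff (r i) (Function.update ρstar i ρi) ≤ payoff (r i) ρstar := by
  let Φ : (∀ j, S j × A j → ℝ) → (∀ j, S j × A j → ℝ) → ℝ := fun ρ τ =>
    ∑ i, (payoff (r i) (Function.update ρ i (τ i)) - payoff (r i) ρ)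
  have hcont : ∀ τ, Continuous fun ρ => Φ ρ τ := fun τ =>
    continuous_finsetSum _ fun i _ => ((continuous_payoff (r i)).comp
      (continuous_id.update i continuous_const)).sub (continuous_payoff (r i))
  have hconc : ∀ ρ, ConcaveOn ℝ (Set.univ.pi P) (Φ ρ) := by
    refine fun ρ => ⟨convex_pi fun i _ => hPcvx i, fun u _ v _ a b _ _ hab => le_of_eq ?_⟩
    simp only [Φ, smul_eq_mul, mul_sum, ← sum_add_distrib]
    refine sum_congr rfl fun i _ => ?_
    rw [Pi.add_apply, Pi.smul_apply, Pi.smul_apply, payoff_update_combo]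
    linear_combination (-payoff (r i) ρ) * hab
  obtain ⟨ρ, hρ, h⟩ := exists_forall_nonpos_of_concaveOn (isCompact_univ_pi hPcpt)
    (Set.univ_pi_nonempty_iff.2 hPne) hcont hconc fun ρ => by simp [Φ]
  rw [Set.mem_univ_pi] at hρ
  refine ⟨ρ, hρ, fun i τ hτ => ?_⟩
  have hi := h (Function.update ρ i τ) (Set.mem_univ_pi.2 fun j => by
    by_cases hj : j = i
    · subst hj
      simpa using hτ
    · simpa [hj] using hρ j)
  simp only [Φ] at hi
  rw [sum_eq_single i (fun j _ hj => by simp [hj]) (by simp), Function.update_self] at hi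
  linarith
end
end

section
/- Assume the dual-averaging setup with gradient-estimate assumptions, where each player i uses its own step sizes η_i^k > 0 satisfying Σ_{k=1}^∞ η_i^k = ∞ and Σ_{k=1}^∞ (η_i^k/w_i^k)² < ∞ with w_i^k = Σ_{ℓ=1}^k η_i^ℓ, and where for a given ε > 0 the bias level for player i is β_i ≤ ε/(3|S_i||A_i|). Let ρ* ∈ P^δ be fixed. If the event {lim_{k→∞} ρ^k = ρ*} has positive probability, then ρ* is an ε-Nash equilibrium of the virtual game with action sets P_1^{δ_1},…,P_n^{δ_n}: V_i(ρ_i, ρ*_{-i}) ≤ V_i(ρ*) + ε for every i and every ρ_i ∈ P_i^{δ_i}. -/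
open scoped BigOperators
open Finset MeasureTheory Filter

noncomputable section

open Classical in
/-- The own-gradient vector `v_i(ρ_{-i})`. -/
def ownGrad {n : ℕ} {S A : Fin n → Type*} [∀ j, Fintype (S j)] [∀ j, Fintype (A j)]
    (ri : (∀ j, S j) → (∀ j, A j) → ℝ) (i : Fin n) (ρ : ∀ j, S j × A j → ℝ) :
    S i × A i → ℝ :=
  fun p => payoff ri (Function.update ρ i (fun q => if q = p then (1:ℝ) else 0))
/-- The payoff is linear in a player's own action, with gradient `ownGrad`. -/
theorem payoff_update_eq_sum_mul_ownGrad {n : ℕ} {S A : Fin n → Type*}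
    [∀ j, Fintype (S j)] [∀ j, Fintype (A j)]
    (ri : (∀ j, S j) → (∀ j, A j) → ℝ) (i : Fin n) (ρ : ∀ j, S j × A j → ℝ)
    (x : S i × A i → ℝ) :
    payoff ri (Function.update ρ i x) = ∑ p, x p * ownGrad ri i ρ p := by
  classical
  have key : ∀ (y : S i × A i → ℝ) (s : ∀ j, S j) (a : ∀ j, A j),
      (∏ j, Function.update ρ i y j (s j, a j)) =
        y (s i, a i) * ∏ j ∈ univ.erase i, ρ j (s j, a j) := by
    intro y s a
    rw [← Finset.mul_prod_erase univ _ (Finset.mem_univ i), Function.update_self]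
    congr 1
    refine Finset.prod_congr rfl fun j hj => ?_
    rw [Function.update_of_ne (Finset.ne_of_mem_erase hj)]
  unfold ownGrad payoff
  simp only [key, Finset.mul_sum]
  conv_rhs => rw [Finset.sum_comm]
  refine Finset.sum_congr rfl fun s _ => ?_
  conv_rhs => rw [Finset.sum_comm]
  refine Finset.sum_congr rfl fun a _ => ?_
  rw [Finset.sum_eq_single (s i, a i)]
  · simp [mul_assoc]
  · intro p _ hp
    simp [hp.symm]
  · simp

theorem continuous_ownGrad {n : ℕ} {S A : Fin n → Type*}
    [∀ j, Fintype (S j)] [∀ j, Fintype (A j)]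
    (ri : (∀ j, S j) → (∀ j, A j) → ℝ) (i : Fin n) (p : S i × A i) :
    Continuous fun ρ : ∀ j, S j × A j → ℝ => ownGrad ri i ρ p := by
  have hpay : Continuous fun ρ : ∀ j, S j × A j → ℝ => payoff ri ρ := by
    unfold payoff
    fun_prop
  exact hpay.comp (continuous_id.update i continuous_const)

/-- Weighted Cesàro averages of a null sequence tend to zero. -/
theorem tendsto_sum_mul_div_sum_zero {g u : ℕ → ℝ} (hg : ∀ k, 0 < g k)
    (hdiv : Tendsto (fun N => ∑ k ∈ range N, g k) atTop atTop)
    (hu : Tendsto u atTop (nhds 0)) :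
    Tendsto (fun N => (∑ k ∈ range N, g k * u k) / ∑ k ∈ range N, g k) atTop (nhds 0) := by
  have hlit : (fun k => g k * u k) =o[atTop] g := by
    simpa using (Asymptotics.isBigO_refl g atTop).mul_isLittleO
      ((Asymptotics.isLittleO_one_iff ℝ).2 hu)
  exact (hlit.sum_range (fun k => (hg k).le) hdiv).tendsto_div_nhds_zero

/-- Kronecker's lemma. -/
theorem tendsto_sum_mul_div_sum_zero_of_summation {g x : ℕ → ℝ} (hg : ∀ k, 0 < g k)
    (hdiv : Tendsto (fun N => ∑ k ∈ range N, g k) atTop atTop) {c : ℝ}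
    (hx : Tendsto (fun N => ∑ k ∈ range N, (g k / ∑ l ∈ range (k + 1), g l) * x k)
      atTop (nhds c)) :
    Tendsto (fun N => (∑ k ∈ range N, g k * x k) / ∑ k ∈ range N, g k) atTop (nhds 0) := by
  set W : ℕ → ℝ := fun N => ∑ k ∈ range N, g k with hW
  set Z : ℕ → ℝ := fun N => (∑ k ∈ range N, (g k / ∑ l ∈ range (k + 1), g l) * x k) - c with hZ
  have hZ0 : Tendsto Z atTop (nhds 0) := by simpa [hZ] using hx.sub_const c
  have hWpos : ∀ N, 0 < W (N + 1) := fun N =>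
    Finset.sum_pos (fun k _ => hg k) ⟨0, by simp⟩
  have habel : ∀ N, ∑ k ∈ range N, g k * x k = W N * Z N - ∑ k ∈ range N, g k * Z k := by
    intro N
    induction N with
    | zero => simp [hW]
    | succ N ih =>
      have hZs : Z (N + 1) = Z N + g N / W (N + 1) * x N := by
        simp only [hZ, hW, Finset.sum_range_succ _ N]
        ring
      have hWs : W (N + 1) = W N + g N := by simp [hW, Finset.sum_range_succ]
      have hmul : W (N + 1) * (g N / W (N + 1) * x N) = g N * x N := by
        have := (hWpos N).ne'
        field_simp
      rw [Finset.sum_range_succ, Finset.sum_range_succ, ih, hZs, mul_add, hmul, hWs]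
      ring
  have hlim := hZ0.sub (tendsto_sum_mul_div_sum_zero hg hdiv hZ0)
  rw [sub_zero] at hlim
  refine hlim.congr' ?_
  filter_upwards [hdiv.eventually_gt_atTop 0] with N hN
  have hN' : W N ≠ 0 := hN.ne'
  change Z N - _ / W N = _ / W N
  rw [habel N]
  field_simp

section Martingale

variable {Ω : Type*} {m0 : MeasurableSpace Ω} {μ : Measure Ω}

theorem integral_mul_eq_zero_of_condExp_eq_zero [IsFiniteMeasure μ] {m : MeasurableSpace Ω}
    (hm : m ≤ m0) {f g : Ω → ℝ} (hf : StronglyMeasurable[m] f) (hf2 : MemLp f 2 μ)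
    (hg2 : MemLp g 2 μ) (hg : μ[g | m] =ᵐ[μ] 0) :
    ∫ ω, f ω * g ω ∂μ = 0 := by
  have hfg : Integrable (f * g) μ := hf2.integrable_mul hg2
  have h1 := condExp_mul_of_stronglyMeasurable_left hf hfg (hg2.integrable one_le_two)
  calc ∫ ω, f ω * g ω ∂μ = ∫ ω, (μ[f * g | m]) ω ∂μ := (integral_condExp hm).symm
    _ = ∫ _, (0 : ℝ) ∂μ := by
        refine integral_congr_ae ?_
        filter_upwards [h1, hg] with ω h1 h2
        simp [h1, h2]
    _ = 0 := by simp

theorem integral_sq_add_of_condExp_eq_zero [IsFiniteMeasure μ] {m : MeasurableSpace Ω}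
    (hm : m ≤ m0) {f g : Ω → ℝ} (hf : StronglyMeasurable[m] f) (hf2 : MemLp f 2 μ)
    (hg2 : MemLp g 2 μ) (hg : μ[g | m] =ᵐ[μ] 0) :
    ∫ ω, (f ω + g ω) ^ 2 ∂μ = ∫ ω, f ω ^ 2 ∂μ + ∫ ω, g ω ^ 2 ∂μ := by
  have hfg : Integrable (fun ω => 2 * (f ω * g ω)) μ := (hf2.integrable_mul hg2).const_mul 2
  have hexp : ∀ ω, (f ω + g ω) ^ 2 = (f ω ^ 2 + g ω ^ 2) + 2 * (f ω * g ω) := fun ω => by ring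
  simp_rw [hexp]
  rw [integral_add (f := fun ω => f ω ^ 2 + g ω ^ 2)
      (hf2.integrable_sq.add hg2.integrable_sq) hfg,
    integral_add hf2.integrable_sq hg2.integrable_sq, integral_const_mul,
    integral_mul_eq_zero_of_condExp_eq_zero hm hf hf2 hg2 hg, mul_zero, add_zero]

/-- A series of square-integrable martingale differences with bounded second moments and
square-summable coefficients converges almost surely. -/
theorem ae_tendsto_sum_mul_of_condExp_eq_zero [IsProbabilityMeasure μ] (F : Filtration ℕ m0)
    {ξ : ℕ → Ω → ℝ} (hξm : ∀ k, StronglyMeasurable[F (k + 1)] (ξ k))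
    (hξ2 : ∀ k, MemLp (ξ k) 2 μ) (hξ0 : ∀ k, μ[ξ k | F k] =ᵐ[μ] 0)
    {C : ℝ} (hξC : ∀ k, ∫ ω, ξ k ω ^ 2 ∂μ ≤ C)
    {c : ℕ → ℝ} (hc : Summable fun k => c k ^ 2) :
    ∀ᵐ ω ∂μ, ∃ l, Tendsto (fun N => ∑ k ∈ range N, c k * ξ k ω) atTop (nhds l) := by
  set f : ℕ → Ω → ℝ := fun N ω => ∑ k ∈ range N, c k * ξ k ω with hf
  have hcξ2 : ∀ k, MemLp (fun ω => c k * ξ k ω) 2 μ := fun k => (hξ2 k).const_mul (c k)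
  have hcξ0 : ∀ k, μ[fun ω => c k * ξ k ω | F k] =ᵐ[μ] 0 := by
    intro k
    filter_upwards [condExp_smul (μ := μ) (c k) (ξ k) (F k), hξ0 k] with ω h1 h2
    change (μ[c k • ξ k | F k]) ω = 0
    simp [h1, h2]
  have hfm : StronglyAdapted F f := by
    intro N
    refine Finset.stronglyMeasurable_fun_sum _ fun k hk => ?_
    exact ((hξm k).mono (F.mono (Finset.mem_range.1 hk))).const_mul (c k)
  have hf2 : ∀ N, MemLp (f N) 2 μ := fun N => memLp_finsetSum _ fun k _ => hcξ2 k
  have hsucc : ∀ N ω, f (N + 1) ω = f N ω + c N * ξ N ω := fun N ω => by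
    simp [hf, Finset.sum_range_succ]
  have hmart : Martingale f F μ := by
    refine martingale_of_condExp_sub_eq_zero_nat hfm
      (fun N => (hf2 N).integrable one_le_two) fun N => ?_
    have : f (N + 1) - f N = fun ω => c N * ξ N ω := by
      funext ω
      simp [hsucc]
    rw [this]
    exact hcξ0 N
  have hC0 : 0 ≤ C := (integral_nonneg fun ω => sq_nonneg (ξ 0 ω)).trans (hξC 0)
  have hbound : ∀ N, ∫ ω, f N ω ^ 2 ∂μ ≤ (∑ k ∈ range N, c k ^ 2) * C := by
    intro N
    induction N with
    | zero => simp [hf]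
    | succ N ih =>
      simp_rw [hsucc]
      rw [integral_sq_add_of_condExp_eq_zero (F.le N) (hfm N) (hf2 N) (hcξ2 N) (hcξ0 N),
        Finset.sum_range_succ, add_mul]
      refine add_le_add ih ?_
      simp_rw [mul_pow]
      rw [integral_const_mul]
      exact mul_le_mul_of_nonneg_left (hξC N) (sq_nonneg _)
  have hL1 : ∀ N, eLpNorm (f N) 1 μ ≤ (Real.toNNReal (1 + (∑' k, c k ^ 2) * C) : NNReal) := by
    intro N
    have hint : Integrable (f N) μ := (hf2 N).integrable one_le_two
    rw [eLpNorm_one_eq_lintegral_enorm, ← ofReal_integral_norm_eq_lintegral_enorm hint]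
    refine ENNReal.ofReal_le_ofReal ?_
    calc ∫ ω, ‖f N ω‖ ∂μ ≤ ∫ ω, (1 + f N ω ^ 2) ∂μ := by
          refine integral_mono hint.norm ((integrable_const 1).add (hf2 N).integrable_sq)
            fun ω => ?_
          change |f N ω| ≤ 1 + f N ω ^ 2
          nlinarith [sq_nonneg (|f N ω| - 1), sq_abs (f N ω), abs_nonneg (f N ω)]
      _ = 1 + ∫ ω, f N ω ^ 2 ∂μ := by
          rw [integral_add (integrable_const 1) (hf2 N).integrable_sq]
          simp
      _ ≤ 1 + (∑' k, c k ^ 2) * C := by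
          have := hc.sum_le_tsum (range N) fun k _ => sq_nonneg (c k)
          have := mul_le_mul_of_nonneg_right this hC0
          linarith [hbound N]
  exact hmart.submartingale.exists_ae_tendsto_of_bdd hL1

/-- Strong law of large numbers for weighted averages of centred square-integrable variables. -/
theorem ae_tendsto_sum_mul_sub_condExp_div_sum [IsProbabilityMeasure μ] (F : Filtration ℕ m0)
    {X : ℕ → Ω → ℝ} (hXm : ∀ k, StronglyMeasurable[F (k + 1)] (X k))
    (hX2 : ∀ k, MemLp (X k) 2 μ) {C : ℝ} (hXC : ∀ k, ∫ ω, X k ω ^ 2 ∂μ ≤ C)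
    {g : ℕ → ℝ} (hg : ∀ k, 0 < g k)
    (hdiv : Tendsto (fun N => ∑ k ∈ range N, g k) atTop atTop)
    (hsq : Summable fun k => (g k / ∑ l ∈ range (k + 1), g l) ^ 2) :
    ∀ᵐ ω ∂μ, Tendsto (fun N => (∑ k ∈ range N, g k * (X k ω - (μ[X k | F k]) ω)) /
      ∑ k ∈ range N, g k) atTop (nhds 0) := by
  have hm2 : ∀ k, MemLp (μ[X k | F k]) 2 μ := fun k => (hX2 k).condExp one_le_two
  have hξ2 : ∀ k, MemLp (fun ω => X k ω - (μ[X k | F k]) ω) 2 μ := fun k => (hX2 k).sub (hm2 k)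
  have hξ0 : ∀ k, μ[fun ω => X k ω - (μ[X k | F k]) ω | F k] =ᵐ[μ] 0 := by
    intro k
    have hi := (hX2 k).integrable one_le_two
    have h1 := condExp_sub hi (integrable_condExp (m := F k) (f := X k)) (F k)
    rw [condExp_of_stronglyMeasurable (F.le k) stronglyMeasurable_condExp integrable_condExp,
      sub_self] at h1
    exact h1
  have hξC : ∀ k, ∫ ω, (X k ω - (μ[X k | F k]) ω) ^ 2 ∂μ ≤ C := by
    intro k
    have h1 := integral_sq_add_of_condExp_eq_zero (F.le k) stronglyMeasurable_condExp
      (hm2 k) (hξ2 k) (hξ0 k)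
    simp only [add_sub_cancel] at h1
    have h2 : 0 ≤ ∫ ω, (μ[X k | F k]) ω ^ 2 ∂μ := integral_nonneg fun ω => sq_nonneg _
    linarith [hXC k]
  have hξm : ∀ k, StronglyMeasurable[F (k + 1)] (fun ω => X k ω - (μ[X k | F k]) ω) := fun k =>
    (hXm k).sub (stronglyMeasurable_condExp.mono (F.mono k.le_succ))
  filter_upwards [ae_tendsto_sum_mul_of_condExp_eq_zero F hξm hξ2 hξ0 hξC hsq] with ω ⟨l, hl⟩
  exact tendsto_sum_mul_div_sum_zero_of_summation hg hdiv hl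

end Martingale

/-- if the dual-averaging iterates converge with positive probability
to some `ρ*`, then `ρ*` is an ε-Nash equilibrium of the virtual game with the
shrunk action sets. -/
theorem positive_probability_limit_is_epsNE
    {n : ℕ} (hn : 0 < n)
    {S A : Fin n → Type*}
    [∀ j, Fintype (S j)] [∀ j, Nonempty (S j)]
    [∀ j, Fintype (A j)] [∀ j, Nonempty (A j)]
    (r : ∀ _ : Fin n, (∀ j, S j) → (∀ j, A j) → ℝ)
    (hr : ∀ i s a, r i s a ∈ Set.Icc (0:ℝ) 1)
    (P : ∀ i : Fin n, Set ((S i × A i) → ℝ))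
    (hPne : ∀ i, (P i).Nonempty) (hPcpt : ∀ i, IsCompact (P i))
    (hPcvx : ∀ i, Convex ℝ (P i)) (hPsub : ∀ i, P i ⊆ probSimplex (S i × A i))
    (δ : Fin n → ℝ) (hδ : ∀ i, δ i ∈ Set.Ioo (0:ℝ) 1)
    (Pδ : ∀ i : Fin n, Set ((S i × A i) → ℝ))
    (hPδdef : ∀ i, Pδ i = {x ∈ P i | ∀ p, δ i ≤ x p})
    (hPδne : ∀ i, (Pδ i).Nonempty)
    -- probability space and filtration
    {Ω : Type*} [m0 : MeasurableSpace Ω] (μ : Measure Ω) [IsProbabilityMeasure μ]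
    (F : Filtration ℕ m0)
    -- regularizers: K-strongly convex and continuous
    (K : ℝ) (hK : 0 < K)
    (h : ∀ i : Fin n, ((S i × A i) → ℝ) → ℝ)
    (hhconv : ∀ i, ConvexOn ℝ (Pδ i) (fun x => h i x - K / 2 * ∑ p, (x p) ^ 2))
    (hhcont : ∀ i, ContinuousOn (h i) (Pδ i))
    -- per-player step sizes: ∑_k η_i^k = ∞ and ∑_k (η_i^k/w_i^k)² < ∞
    (η : Fin n → ℕ → ℝ) (hη : ∀ i k, 0 < η i k)
    (w : Fin n → ℕ → ℝ) (hw : ∀ i k, w i k = ∑ ℓ ∈ Finset.Icc 1 k, η i ℓ)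
    (hdiv : ∀ i, Tendsto (w i) atTop atTop)
    (hsq : ∀ i, Summable (fun k : ℕ => (η i (k + 1) / w i (k + 1)) ^ 2))
    -- gradient estimates: F^k-measurable, square-integrable
    (R : ℕ → Ω → ∀ i : Fin n, (S i × A i) → ℝ)
    (hRmeas : ∀ k i p, Measurable[F k] (fun ω => R k ω i p))
    (hRsq : ∀ k i, Integrable (fun ω => ∑ p, (R k ω i p) ^ 2) μ)
    -- dual scores
    (Y : ℕ → Ω → ∀ i : Fin n, (S i × A i) → ℝ)
    (hY1 : ∀ ω i p, Y 1 ω i p = 0)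
    (hYrec : ∀ k, 1 ≤ k → ∀ ω i p, Y (k + 1) ω i p = Y k ω i p + η i k * R k ω i p)
    -- iterates: ρ_i^k = argmax over Pδ_i of ⟨ρ_i, Y_i^k⟩ − h_i(ρ_i)
    (ρ : ℕ → Ω → ∀ j, S j × A j → ℝ)
    (hρ : ∀ k, 1 ≤ k → ∀ ω i, ρ k ω i ∈ Pδ i ∧
      ∀ x ∈ Pδ i, (∑ p, x p * Y k ω i p) - h i x ≤
        (∑ p, ρ k ω i p * Y k ω i p) - h i (ρ k ω i))
    -- accuracy and per-player bias levels
    (ε : ℝ) (hε : 0 < ε) (β : Fin n → ℝ)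
    (hβ : ∀ i, β i ≤ ε / (3 * (Fintype.card (S i) : ℝ) * (Fintype.card (A i) : ℝ)))
    -- gradient-estimate assumptions: bias and conditional second moment
    (hbias : ∀ k, 1 ≤ k → ∀ i, ∀ᵐ ω ∂μ, ∀ p,
      |(μ[(fun ω' => R k ω' i p) | F (k - 1)]) ω - ownGrad (r i) i (ρ k ω) p| ≤ β i)
    (hmom : ∀ k, 1 ≤ k → ∀ i, ∀ᵐ ω ∂μ,
      (μ[(fun ω' => ∑ p, (R k ω' i p) ^ 2) | F (k - 1)]) ω ≤
        ((Fintype.card (S i) : ℝ) * (Fintype.card (A i) : ℝ)) / δ i)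
    -- the iterates converge to ρ* with positive probability
    (ρstar : ∀ j, S j × A j → ℝ) (hρstarmem : ∀ i, ρstar i ∈ Pδ i)
    (hpos : 0 < μ {ω | Tendsto (fun k => ρ k ω) atTop (nhds ρstar)}) :
    -- conclusion: ρ* is an ε-NE of the virtual game with action sets Pδ
    ∀ i : Fin n, ∀ ρi ∈ Pδ i,
      payoff (r i) (Function.update ρstar i ρi) ≤ payoff (r i) ρstar + ε := by
  intro i x hx
  have hstep : ∀ N, w i N = ∑ k ∈ range N, η i (k + 1) := by
    intro N
    rw [hw, Finset.range_eq_Ico, Finset.sum_Ico_add' (fun k => η i k) 0 N 1]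
    rfl
  have hdiv' : Tendsto (fun N => ∑ k ∈ range N, η i (k + 1)) atTop atTop :=
    (hdiv i).congr hstep
  have hsq' : Summable fun k => (η i (k + 1) / ∑ l ∈ range (k + 1), η i (l + 1)) ^ 2 := by
    simpa only [hstep] using hsq i
  have hXm : ∀ p k, StronglyMeasurable[F (k + 1)] (fun ω => R (k + 1) ω i p) :=
    fun p k => (hRmeas (k + 1) i p).stronglyMeasurable
  have hX2 : ∀ p k, MemLp (fun ω => R (k + 1) ω i p) 2 μ := by
    intro p k
    have hsm := ((hXm p k).mono (F.le (k + 1))).aestronglyMeasurable (μ := μ)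
    refine (memLp_two_iff_integrable_sq hsm).2 ((hRsq (k + 1) i).mono' (hsm.pow 2) ?_)
    refine Eventually.of_forall fun ω => ?_
    rw [Real.norm_of_nonneg (sq_nonneg _)]
    exact Finset.single_le_sum (f := fun q => R (k + 1) ω i q ^ 2)
      (fun q _ => sq_nonneg _) (Finset.mem_univ p)
  have hXC : ∀ p k, ∫ ω, R (k + 1) ω i p ^ 2 ∂μ ≤
      ((Fintype.card (S i) : ℝ) * (Fintype.card (A i) : ℝ)) / δ i := by
    intro p k
    calc ∫ ω, R (k + 1) ω i p ^ 2 ∂μ ≤ ∫ ω, ∑ q, R (k + 1) ω i q ^ 2 ∂μ :=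
          integral_mono (hX2 p k).integrable_sq (hRsq (k + 1) i) fun ω =>
            Finset.single_le_sum (f := fun q => R (k + 1) ω i q ^ 2)
              (fun q _ => sq_nonneg _) (Finset.mem_univ p)
      _ = ∫ ω, (μ[(fun ω' => ∑ q, R (k + 1) ω' i q ^ 2) | F k]) ω ∂μ :=
          (integral_condExp (F.le k)).symm
      _ ≤ ∫ _, ((Fintype.card (S i) : ℝ) * (Fintype.card (A i) : ℝ)) / δ i ∂μ :=
          integral_mono_ae integrable_condExp (integrable_const _)
            (hmom (k + 1) (Nat.le_add_left 1 k) i)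
      _ = ((Fintype.card (S i) : ℝ) * (Fintype.card (A i) : ℝ)) / δ i := by simp
  have hnoise := ae_all_iff.2 fun p => ae_tendsto_sum_mul_sub_condExp_div_sum (μ := μ) F
    (hXm p) (hX2 p) (hXC p) (fun k => hη i (k + 1)) hdiv' hsq'
  have hbias' := ae_all_iff.2 fun k => hbias (k + 1) (Nat.le_add_left 1 k) i
  obtain ⟨ω, hlim, hM, hb⟩ :=
    ((frequently_ae_iff.2 hpos.ne').and_eventually (hnoise.and hbias')).exists
  simp only [Nat.add_sub_cancel] at hb
  set g : ℕ → ℝ := fun k => η i (k + 1) with hg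
  set W : ℕ → ℝ := fun N => ∑ k ∈ range N, g k with hW
  set m : ℕ → S i × A i → ℝ := fun k p => (μ[(fun ω' => R (k + 1) ω' i p) | F k]) ω with hm
  set v : S i × A i → ℝ := ownGrad (r i) i ρstar with hv
  set M : ℕ → S i × A i → ℝ := fun N p => ∑ k ∈ range N, g k * (R (k + 1) ω i p - m k p)
  set D : ℕ → S i × A i → ℝ := fun N p =>
    ∑ k ∈ range N, g k * (ownGrad (r i) i (ρ (k + 1) ω) p - v p)
  set B : ℕ → S i × A i → ℝ := fun N p =>
    ∑ k ∈ range N, g k * (m k p - ownGrad (r i) i (ρ (k + 1) ω) p)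
  have hgpos : ∀ k, 0 < g k := fun k => hη i (k + 1)
  have hρlim : Tendsto (fun N => ρ (N + 1) ω) atTop (nhds ρstar) :=
    (tendsto_add_atTop_iff_nat 1).2 hlim
  have hρilim : Tendsto (fun N => ρ (N + 1) ω i) atTop (nhds (ρstar i)) :=
    (tendsto_pi_nhds.1 hρlim) i
  have hD : ∀ p, Tendsto (fun N => D N p / W N) atTop (nhds 0) := by
    intro p
    refine tendsto_sum_mul_div_sum_zero hgpos hdiv' ?_
    have := (((continuous_ownGrad (r i) i p).tendsto ρstar).comp hρlim).sub_const (v p)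
    simpa [hv] using this
  have hBle : ∀ N p, |B N p| ≤ β i * W N := by
    intro N p
    calc |B N p| ≤ ∑ k ∈ range N, |g k * (m k p - ownGrad (r i) i (ρ (k + 1) ω) p)| :=
          Finset.abs_sum_le_sum_abs _ _
      _ ≤ ∑ k ∈ range N, β i * g k := by
          refine Finset.sum_le_sum fun k _ => ?_
          rw [abs_mul, abs_of_pos (hgpos k), mul_comm]
          exact mul_le_mul_of_nonneg_right (hb k p) (hgpos k).le
      _ = β i * W N := (Finset.mul_sum _ _ _).symm
  have hY : ∀ N p, Y (N + 1) ω i p = M N p + B N p + D N p + W N * v p := by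
    intro N p
    induction N with
    | zero => simp [M, B, D, hW, hY1]
    | succ N ih =>
      rw [hYrec (N + 1) (Nat.le_add_left 1 N), ih]
      simp only [M, B, D, hW, Finset.sum_range_succ, hg]
      ring
  have hleft : Tendsto (fun N => ∑ p, (x p - ρ (N + 1) ω i p) *
        (M N p / W N + D N p / W N + v p) - β i * ∑ p, |x p - ρ (N + 1) ω i p|) atTop
      (nhds (∑ p, (x p - ρstar i p) * (0 + 0 + v p) - β i * ∑ p, |x p - ρstar i p|)) := by
    have hdiff : ∀ p, Tendsto (fun N => x p - ρ (N + 1) ω i p) atTop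
        (nhds (x p - ρstar i p)) := fun p => ((tendsto_pi_nhds.1 hρilim) p).const_sub (x p)
    refine Tendsto.sub (tendsto_finsetSum _ fun p _ => (hdiff p).mul
      (((hM p).add (hD p)).add_const (v p))) (Tendsto.const_mul _ ?_)
    exact tendsto_finsetSum _ fun p _ => (hdiff p).abs
  have hright : Tendsto (fun N => (h i x - h i (ρ (N + 1) ω i)) / W N) atTop (nhds 0) := by
    have hh : Tendsto (fun N => h i (ρ (N + 1) ω i)) atTop (nhds (h i (ρstar i))) :=
      (hhcont i (ρstar i) (hρstarmem i)).tendsto.comp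
        (tendsto_nhdsWithin_iff.2 ⟨hρilim, Eventually.of_forall fun N =>
          (hρ (N + 1) (Nat.le_add_left 1 N) ω i).1⟩)
    exact (hh.const_sub (h i x)).div_atTop hdiv'
  have hmain : ∑ p, (x p - ρstar i p) * v p ≤ β i * ∑ p, |x p - ρstar i p| := by
    have := le_of_tendsto_of_tendsto hleft hright ?_
    · simp only [zero_add] at this
      linarith
    filter_upwards [hdiv'.eventually_gt_atTop 0] with N hN
    have hN' : 0 < W N := hN
    rw [le_div_iff₀ hN']
    have hopt := (hρ (N + 1) (Nat.le_add_left 1 N) ω i).2 x hx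
    have hopt' : ∑ p, (x p - ρ (N + 1) ω i p) * Y (N + 1) ω i p ≤
        h i x - h i (ρ (N + 1) ω i) := by
      simp only [sub_mul, Finset.sum_sub_distrib]
      linarith
    refine le_trans ?_ hopt'
    rw [sub_mul, Finset.mul_sum univ _ (β i), Finset.sum_mul univ, Finset.sum_mul univ,
      ← Finset.sum_sub_distrib]
    refine Finset.sum_le_sum fun p _ => ?_
    have hcancel : (M N p / W N + D N p / W N + v p) * W N = M N p + D N p + W N * v p := by
      field_simp
    have hlow : -(|x p - ρ (N + 1) ω i p| * (β i * W N)) ≤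
        (x p - ρ (N + 1) ω i p) * B N p := by
      refine neg_le_of_abs_le ?_
      rw [abs_mul]
      exact mul_le_mul_of_nonneg_left (hBle N p) (abs_nonneg _)
    rw [hY, mul_assoc, hcancel]
    linarith
  have hsimplex : ∀ y ∈ Pδ i, (∀ p, 0 ≤ y p) ∧ ∑ p, y p = 1 := fun y hy =>
    hPsub i (by rw [hPδdef i] at hy; exact hy.1)
  obtain ⟨hx0, hx1⟩ := hsimplex x hx
  obtain ⟨hs0, hs1⟩ := hsimplex _ (hρstarmem i)
  have hdist : ∑ p, |x p - ρstar i p| ≤ 2 := by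
    calc ∑ p, |x p - ρstar i p| ≤ ∑ p, (x p + ρstar i p) :=
          Finset.sum_le_sum fun p _ => abs_le.2
            ⟨by linarith [hx0 p, hs0 p], by linarith [hx0 p, hs0 p]⟩
      _ = 2 := by rw [Finset.sum_add_distrib, hx1, hs1]; norm_num
  have hβε : β i ≤ ε / 3 := by
    have hS : (1 : ℝ) ≤ Fintype.card (S i) := by exact_mod_cast Fintype.card_pos
    have hA : (1 : ℝ) ≤ Fintype.card (A i) := by exact_mod_cast Fintype.card_pos
    refine (hβ i).trans (div_le_div_of_nonneg_left hε.le (by norm_num) ?_)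
    nlinarith
  have hstar : payoff (r i) ρstar = ∑ p, ρstar i p * v p := by
    rw [hv, ← payoff_update_eq_sum_mul_ownGrad, Function.update_eq_self]
  rw [payoff_update_eq_sum_mul_ownGrad, hstar]
  simp only [sub_mul, Finset.sum_sub_distrib] at hmain
  have hnn : 0 ≤ ∑ p, |x p - ρstar i p| := Finset.sum_nonneg fun p _ => abs_nonneg _
  nlinarith
end
end
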